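/- There exist universal constants C ≥ c > 0 such that for every integer n ≥ 3, if X is a random vector in ℝ^n with the standard normal distribution N(0, I_n), then with probability at least 0.51 the following event occurs: for every integer i with 1 ≤ i ≤ (n+1)/2, c·√(ln(n/i)) ≤ X_[i] ≤ C·√(ln(n/i)). -/

import Mathlib

open MeasureTheory ProbabilityTheory

/-- `decRe x` is the non-increasing rearrangement of `(|x_1|, …, |x_n|)`
(indexed from `0`, so `decRe x i = x_[i+1]` in the paper's notation). -/
noncomputable def decRe {n : ℕ} (x : Fin n → ℝ) : Fin n → ℝ :=
  fun i => |x (Tuple.sort (fun j => |x j|) i.rev)|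

/-- The standard Gaussian measure `N(0, I_n)` on `ℝ^n`. -/
noncomputable def stdGaussian (n : ℕ) : Measure (Fin n → ℝ) :=
  Measure.pi fun _ => gaussianReal 0 1

section OrderStatistics

variable {n : ℕ}

/-- If the `i`-th largest absolute value is below `s`, then at most `i` coordinates reach `s`. -/
lemma card_le_of_decRe_lt (x : Fin n → ℝ) (i : Fin n) {s : ℝ} (h : decRe x i < s) :
    (Finset.univ.filter fun j => s ≤ |x j|).card ≤ i := by
  set σ := Tuple.sort fun j => |x j| with hσ
  have hmono : Monotone ((fun j => |x j|) ∘ σ) := Tuple.monotone_sort _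
  have hsub : (Finset.univ.filter fun j => s ≤ |x j|) ⊆ (Finset.Ioi i.rev).image σ := by
    intro j hj
    have hj' : s ≤ |x j| := (Finset.mem_filter.mp hj).2
    refine Finset.mem_image.mpr ⟨σ.symm j, Finset.mem_Ioi.mpr ?_, σ.apply_symm_apply j⟩
    by_contra! hle
    have hle' := hmono hle
    simp only [Function.comp_apply, Equiv.apply_symm_apply] at hle'
    exact absurd (hj'.trans hle') (not_le.mpr h)
  calc _ ≤ ((Finset.Ioi i.rev).image σ).card := Finset.card_le_card hsub
    _ ≤ (Finset.Ioi i.rev).card := Finset.card_image_le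
    _ ≤ i := by rw [Fin.card_Ioi, Fin.val_rev]; omega

lemma mul_decRe_le_sum (x : Fin n → ℝ) (i : Fin n) {g : ℝ → ℝ} (hg0 : ∀ t, 0 ≤ g t)
    (hg : MonotoneOn g (Set.Ici 0)) :
    ((i : ℝ) + 1) * g (decRe x i) ≤ ∑ j, g |x j| := by
  set σ := Tuple.sort fun j => |x j| with hσ
  have hmono : Monotone ((fun j => |x j|) ∘ σ) := Tuple.monotone_sort _
  have hcard : ((Finset.Ici i.rev).card : ℝ) = i + 1 := by
    have : (Finset.Ici i.rev).card = i + 1 := by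
      rw [Fin.card_Ici, Fin.val_rev]; omega
    rw [this]; push_cast; ring
  calc ((i : ℝ) + 1) * g (decRe x i) = ∑ j ∈ Finset.Ici i.rev, g (decRe x i) := by
        rw [Finset.sum_const, nsmul_eq_mul, hcard]
    _ ≤ ∑ j ∈ Finset.Ici i.rev, g |x (σ j)| :=
        Finset.sum_le_sum fun j hj =>
          hg (Set.mem_Ici.mpr (abs_nonneg _)) (Set.mem_Ici.mpr (abs_nonneg _))
            (hmono (Finset.mem_Ici.mp hj))
    _ ≤ ∑ j, g |x (σ j)| :=
        Finset.sum_le_sum_of_subset_of_nonneg (Finset.subset_univ _) fun _ _ _ => hg0 _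
    _ = ∑ j, g |x j| := Equiv.sum_comp σ fun j => g |x j|

/-- Exponential Markov bound for the number of coordinates of absolute value at least `s`. -/
lemma measureReal_decRe_lt_mul_pow_le (γ : Measure ℝ) [IsProbabilityMeasure γ] (i : Fin n)
    (s : ℝ) {w : ℝ} (hw0 : 0 < w) (hw1 : w ≤ 1) :
    w ^ (i : ℕ) * (Measure.pi fun _ : Fin n => γ).real {x | decRe x i < s} ≤
      (1 - (1 - w) * γ.real {y | s ≤ |y|}) ^ n := by
  classical
  set A : Set ℝ := {y | s ≤ |y|} with hA
  have hAm : MeasurableSet A := measurableSet_le measurable_const measurable_id.abs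
  set f : ℝ → ℝ := fun y => 1 - (1 - w) * A.indicator 1 y with hf
  have hindi : Integrable (A.indicator (1 : ℝ → ℝ)) γ :=
    (integrable_const (1 : ℝ)).indicator hAm
  have hfi : Integrable f γ := (integrable_const 1).sub (hindi.const_mul _)
  have hmean : ∫ y, f y ∂γ = 1 - (1 - w) * γ.real A := by
    simp only [hf]
    rw [integral_sub (integrable_const 1) (hindi.const_mul _), integral_const_mul,
      integral_indicator_one hAm]
    simp
  have hfv : ∀ y, f y = if s ≤ |y| then w else 1 := by
    intro y
    by_cases hy : s ≤ |y| <;> simp [hf, hA, Set.indicator, hy]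
  have hf0 : ∀ y, 0 ≤ f y := fun y => by rw [hfv]; split_ifs <;> linarith
  have hmarkov := mul_meas_ge_le_integral_of_nonneg
    (μ := Measure.pi fun _ : Fin n => γ) (f := fun x => ∏ j, f (x j))
    (Filter.Eventually.of_forall fun x => Finset.prod_nonneg fun j _ => hf0 _)
    (Integrable.fintype_prod fun _ => hfi) (w ^ (i : ℕ))
  rw [integral_fintype_prod_eq_pow, Fintype.card_fin, hmean] at hmarkov
  refine le_trans (mul_le_mul_of_nonneg_left (measureReal_mono ?_) (by positivity)) hmarkov
  intro x hx
  simp only [Set.mem_ofPred_eq, hfv]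
  rw [Finset.prod_ite, Finset.prod_const, Finset.prod_const_one, mul_one]
  exact pow_le_pow_of_le_one hw0.le hw1 (card_le_of_decRe_lt x i hx)

end OrderStatistics

section Gaussian

lemma gaussianReal_real_eq_integral (s : Set ℝ) :
    (gaussianReal 0 1).real s = ∫ x in s, gaussianPDFReal 0 1 x := by
  rw [measureReal_def, gaussianReal_apply_eq_integral 0 one_ne_zero, ENNReal.toReal_ofReal]
  exact integral_nonneg fun x => gaussianPDFReal_nonneg 0 1 x

lemma gaussianPDFReal_std (x : ℝ) :
    gaussianPDFReal 0 1 x = (√(2 * Real.pi))⁻¹ * Real.exp (-x ^ 2 / 2) := by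
  simp [gaussianPDFReal_def]

lemma two_le_sqrt_two_pi : 2 ≤ √(2 * Real.pi) :=
  Real.le_sqrt_of_sq_le (by linarith [Real.pi_gt_three])

lemma exp_neg_one_le_inv_sqrt_two_pi : Real.exp (-1) ≤ (√(2 * Real.pi))⁻¹ := by
  rw [Real.exp_neg]
  refine inv_anti₀ (by positivity) (Real.sqrt_le_iff.mpr ⟨by positivity, ?_⟩)
  nlinarith [Real.exp_one_gt_d9, Real.pi_lt_d2]

lemma gaussianReal_real_abs_lt_le {s : ℝ} (hs : 0 ≤ s) :
    (gaussianReal 0 1).real {y | |y| < s} ≤ s := by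
  have hset : {y : ℝ | |y| < s} = Set.Ioo (-s) s := by
    ext y; simp [abs_lt]
  rw [gaussianReal_real_eq_integral, hset]
  have h := norm_setIntegral_le_of_norm_le_const (μ := volume) (s := Set.Ioo (-s) s)
    (f := gaussianPDFReal 0 1) (C := 2⁻¹) (by simp) fun y _ => by
      rw [Real.norm_of_nonneg (gaussianPDFReal_nonneg 0 1 y), gaussianPDFReal_std]
      calc (√(2 * Real.pi))⁻¹ * Real.exp (-y ^ 2 / 2) ≤ 2⁻¹ * 1 := by
            gcongr
            · exact two_le_sqrt_two_pi
            · exact Real.exp_le_one_iff.mpr (by nlinarith [sq_nonneg y])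
        _ = 2⁻¹ := mul_one _
  rw [Real.volume_real_Ioo_of_le (by linarith)] at h
  calc _ ≤ _ := Real.le_norm_self _
    _ ≤ _ := h
    _ = s := by ring

lemma one_sub_le_gaussianReal_real_le_abs {s : ℝ} (hs : 0 ≤ s) :
    1 - s ≤ (gaussianReal 0 1).real {y | s ≤ |y|} := by
  have hm : MeasurableSet {y : ℝ | |y| < s} := measurableSet_lt measurable_id.abs measurable_const
  have hset : {y : ℝ | s ≤ |y|} = {y : ℝ | |y| < s}ᶜ := by ext y; simp
  rw [hset, probReal_compl_eq_one_sub hm]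
  linarith [gaussianReal_real_abs_lt_le hs]

lemma exp_neg_le_gaussianReal_real_le_abs (s : ℝ) :
    Real.exp (-(s ^ 2 + 2)) ≤ (gaussianReal 0 1).real {y | s ≤ |y|} := by
  have hsub : Set.Icc s (s + 1) ⊆ {y : ℝ | s ≤ |y|} := fun y hy => hy.1.trans (le_abs_self y)
  refine le_trans ?_ (measureReal_mono hsub)
  rw [gaussianReal_real_eq_integral]
  have h := setIntegral_ge_of_const_le_real (μ := volume) (s := Set.Icc s (s + 1))
    (f := gaussianPDFReal 0 1) (c := Real.exp (-(s ^ 2 + 2))) measurableSet_Icc (by simp)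
    (fun y hy => by
      rw [gaussianPDFReal_std]
      calc Real.exp (-(s ^ 2 + 2)) = Real.exp (-1) * Real.exp (-(s ^ 2 + 1)) := by
            rw [← Real.exp_add]; ring_nf
        _ ≤ (√(2 * Real.pi))⁻¹ * Real.exp (-y ^ 2 / 2) := by
            gcongr
            · exact exp_neg_one_le_inv_sqrt_two_pi
            · have h1 := hy.1
              have h2 := hy.2
              nlinarith [sq_nonneg (s - 1)])
    (integrable_gaussianPDFReal 0 1).integrableOn
  rw [Real.volume_real_Icc_of_le (by linarith)] at h
  linarith

lemma integral_exp_sq_div_four_gaussianReal :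
    ∫ x, Real.exp (x ^ 2 / 4) ∂gaussianReal 0 1 = √2 := by
  rw [integral_gaussianReal_eq_integral_smul one_ne_zero]
  have h : ∀ x : ℝ, gaussianPDFReal 0 1 x • Real.exp (x ^ 2 / 4) =
      (√(2 * Real.pi))⁻¹ * Real.exp (-(1 / 4) * x ^ 2) := by
    intro x
    rw [gaussianPDFReal_std, smul_eq_mul, mul_assoc, ← Real.exp_add]
    ring_nf
  simp_rw [h]
  rw [integral_const_mul, integral_gaussian, ← Real.sqrt_inv, ← Real.sqrt_mul (by positivity)]
  congr 1
  field_simp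
  norm_num

lemma measureReal_sum_exp_sq_ge_le {n : ℕ} (hn : 0 < n) :
    (Measure.pi fun _ : Fin n => gaussianReal 0 1).real
      {x | 10 * (n : ℝ) ≤ ∑ j, Real.exp (|x j| ^ 2 / 4)} ≤ 1 / 5 := by
  have hi : Integrable (fun x : ℝ => Real.exp (x ^ 2 / 4)) (gaussianReal 0 1) := by
    apply Integrable.of_integral_ne_zero
    rw [integral_exp_sq_div_four_gaussianReal]
    positivity
  have hi' : ∀ j ∈ (Finset.univ : Finset (Fin n)),
      Integrable (fun x : Fin n → ℝ => Real.exp (x j ^ 2 / 4))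
        (Measure.pi fun _ : Fin n => gaussianReal 0 1) := fun j _ =>
    integrable_comp_eval (μ := fun _ : Fin n => gaussianReal 0 1) (i := j) hi
  have h := mul_meas_ge_le_integral_of_nonneg
    (μ := Measure.pi fun _ : Fin n => gaussianReal 0 1)
    (f := fun x => ∑ j, Real.exp (x j ^ 2 / 4))
    (Filter.Eventually.of_forall fun x => Finset.sum_nonneg fun j _ => (Real.exp_pos _).le)
    (integrable_finsetSum _ hi') (10 * n)
  rw [integral_finsetSum _ hi'] at h
  have hj : ∀ j : Fin n, ∫ x : Fin n → ℝ, Real.exp (x j ^ 2 / 4)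
      ∂(Measure.pi fun _ : Fin n => gaussianReal 0 1) = √2 := fun j => by
    rw [← integral_exp_sq_div_four_gaussianReal]
    exact integral_comp_eval (μ := fun _ : Fin n => gaussianReal 0 1) (i := j)
      (f := fun y : ℝ => Real.exp (y ^ 2 / 4)) hi.aestronglyMeasurable
  simp only [hj, Finset.sum_const, Finset.card_univ, Fintype.card_fin, nsmul_eq_mul] at h
  simp only [sq_abs]
  have hn' : (0 : ℝ) < n := by exact_mod_cast hn
  have h2 : √2 ≤ 2 := Real.sqrt_le_iff.mpr ⟨by norm_num, by norm_num⟩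
  have h3 : (n : ℝ) * √2 ≤ n * 2 := by gcongr
  rw [← mul_le_mul_iff_right₀ (show (0 : ℝ) < 10 * n by positivity)]
  linarith

end Gaussian

section Bounds

variable {n : ℕ}

lemma one_third_le_log_div (hn : 3 ≤ n) (i : Fin n) (hi : (i : ℝ) + 1 ≤ ((n : ℝ) + 1) / 2) :
    1 / 3 ≤ Real.log ((n : ℝ) / ((i : ℝ) + 1)) := by
  have hn' : (3 : ℝ) ≤ n := by exact_mod_cast hn
  have hi0 : (0 : ℝ) < (i : ℝ) + 1 := by positivity
  have h := Real.one_sub_inv_le_log_of_pos (show 0 < (n : ℝ) / ((i : ℝ) + 1) by positivity)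
  have h2 : ((n : ℝ) / ((i : ℝ) + 1))⁻¹ ≤ 2 / 3 := by
    rw [inv_div, div_le_iff₀ (by positivity)]
    linarith
  linarith

lemma decRe_le_of_sum_exp_lt (hn : 3 ≤ n) (x : Fin n → ℝ)
    (hx : ∑ j, Real.exp (|x j| ^ 2 / 4) < 10 * (n : ℝ)) (i : Fin n)
    (hi : (i : ℝ) + 1 ≤ ((n : ℝ) + 1) / 2) :
    decRe x i ≤ 11 * √(Real.log ((n : ℝ) / ((i : ℝ) + 1))) := by
  have hL := one_third_le_log_div hn i hi
  have hn' : (3 : ℝ) ≤ n := by exact_mod_cast hn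
  have hi0 : (0 : ℝ) < (i : ℝ) + 1 := by positivity
  set L := Real.log ((n : ℝ) / ((i : ℝ) + 1)) with hLdef
  have h1 := mul_decRe_le_sum x i (g := fun t => Real.exp (t ^ 2 / 4))
    (fun t => (Real.exp_pos _).le) fun a ha b _ hab => by
      have ha' : 0 ≤ a := ha
      have : a ^ 2 ≤ b ^ 2 := by gcongr
      exact Real.exp_le_exp.mpr (by linarith)
  have h2 : Real.exp (decRe x i ^ 2 / 4) ≤ 10 * ((n : ℝ) / ((i : ℝ) + 1)) := by
    rw [← mul_div_assoc, le_div_iff₀ hi0, mul_comm]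
    exact h1.trans hx.le
  have h3 := Real.log_le_log (Real.exp_pos _) h2
  rw [Real.log_exp, Real.log_mul (by norm_num) (by positivity), ← hLdef] at h3
  have h4 := Real.log_le_sub_one_of_pos (show (0 : ℝ) < 10 by norm_num)
  refine abs_le_of_sq_le_sq' (b := 11 * √L) ?_ (by positivity) |>.2
  rw [mul_pow, Real.sq_sqrt (by linarith)]
  linarith

lemma measureReal_decRe_lt_le_of_small (i : Fin n) (hi : (i : ℝ) + 1 ≤ ((n : ℝ) + 1) / 2)
    {s : ℝ} (hs0 : 0 ≤ s) (hs : s ≤ 1 / 100) :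
    (Measure.pi fun _ : Fin n => gaussianReal 0 1).real {x | decRe x i < s} ≤ 1 / (10 * n) := by
  have h := measureReal_decRe_lt_mul_pow_le (gaussianReal 0 1) i s (w := 1 / 100)
    (by norm_num) (by norm_num)
  set p := (Measure.pi fun _ : Fin n => gaussianReal 0 1).real {x | decRe x i < s}
  have hq := one_sub_le_gaussianReal_real_le_abs hs0
  have hq1 : (gaussianReal 0 1).real {y | s ≤ |y|} ≤ 1 := measureReal_le_one
  have hn0 : 0 < n := i.pos
  have hn' : (0 : ℝ) < n := by exact_mod_cast hn0
  have hbase : (1 - (1 - 1 / 100) * (gaussianReal 0 1).real {y | s ≤ |y|}) ^ n ≤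
      (1 / 50 : ℝ) ^ n := by
    apply pow_le_pow_left₀ <;> linarith
  have h2i : 2 * (i : ℕ) + 1 ≤ n := by
    have : (2 : ℝ) * (i : ℕ) + 1 ≤ n := by linarith
    exact_mod_cast this
  have hw : (1 / 10 : ℝ) ^ n * 10 ≤ (1 / 100) ^ (i : ℕ) := by
    calc (1 / 10 : ℝ) ^ n * 10 ≤ (1 / 10) ^ (2 * (i : ℕ) + 1) * 10 := by
          gcongr ?_ * 10
          exact pow_le_pow_of_le_one (by norm_num) (by norm_num) h2i
      _ = (1 / 100) ^ (i : ℕ) := by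
          rw [pow_succ, pow_mul]; norm_num; ring
  have hp : 0 ≤ p := measureReal_nonneg
  have h5 : (n : ℝ) ≤ 5 ^ n := by exact_mod_cast (Nat.lt_pow_self (by norm_num)).le
  have h3 : (1 / 10 : ℝ) ^ n * 10 * p ≤ (1 / 50) ^ n :=
    (mul_le_mul_of_nonneg_right hw hp).trans (h.trans hbase)
  have h4 : (1 / 50 : ℝ) ^ n = (1 / 10) ^ n * (1 / 5) ^ n := by rw [← mul_pow]; norm_num
  rw [h4, mul_assoc] at h3
  have h6 := le_of_mul_le_mul_left h3 (by positivity)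
  have h7 : (1 / 5 : ℝ) ^ n ≤ 1 / n := by
    rw [one_div_pow]
    exact one_div_le_one_div_of_le hn' h5
  have h8 : 1 / (10 * (n : ℝ)) = 1 / n / 10 := by field_simp
  rw [h8]
  linarith

lemma measureReal_decRe_lt_le_of_large (i : Fin n)
    (hL : 100 ≤ Real.log ((n : ℝ) / ((i : ℝ) + 1))) :
    (Measure.pi fun _ : Fin n => gaussianReal 0 1).real
      {x | decRe x i < 1 / 1000 * √(Real.log ((n : ℝ) / ((i : ℝ) + 1)))} ≤ 1 / (10 * n) := by
  set L := Real.log ((n : ℝ) / ((i : ℝ) + 1)) with hLdef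
  set s := 1 / 1000 * √L with hs
  have hn0 : 0 < n := i.pos
  have hn' : (0 : ℝ) < n := by exact_mod_cast hn0
  set k : ℝ := (i : ℝ) + 1 with hk
  have hk1 : 1 ≤ k := by rw [hk]; linarith [Nat.cast_nonneg (α := ℝ) (i : ℕ)]
  have h := measureReal_decRe_lt_mul_pow_le (gaussianReal 0 1) i s (w := 1 / 2)
    (by norm_num) (by norm_num)
  set p := (Measure.pi fun _ : Fin n => gaussianReal 0 1).real {x | decRe x i < s}
  set q := (gaussianReal 0 1).real {y | s ≤ |y|} with hqdef
  have hq1 : q ≤ 1 := measureReal_le_one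
  have hq : Real.exp (-(L / 4)) ≤ q := by
    refine le_trans (Real.exp_le_exp.mpr ?_) (exp_neg_le_gaussianReal_real_le_abs s)
    rw [hs, mul_pow, Real.sq_sqrt (by linarith)]
    linarith
  set a := Real.exp (L / 4) with ha
  have ha26 : 26 ≤ a := by linarith [Real.add_one_le_exp (L / 4)]
  have hna : (n : ℝ) = k * a ^ 4 := by
    have : a ^ 4 = n / k := by
      rw [ha, ← Real.exp_nat_mul, ← Real.exp_log (show 0 < (n : ℝ) / k by positivity), ← hLdef]
      congr 1
      push_cast
      ring
    rw [this]; field_simp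
  have hnq : k * a ^ 3 ≤ n * q := by
    have : (n : ℝ) * Real.exp (-(L / 4)) = k * a ^ 3 := by
      rw [Real.exp_neg, ← ha, hna]; field_simp
    rw [← this]; gcongr
  have hp : 0 ≤ p := measureReal_nonneg
  have hbase : (1 - (1 - 1 / 2) * q) ^ n ≤ Real.exp (-(n * q / 2)) := by
    calc (1 - (1 - 1 / 2) * q) ^ n ≤ Real.exp (-(q / 2)) ^ n := by
          apply pow_le_pow_left₀ (by linarith)
          linarith [Real.add_one_le_exp (-(q / 2))]
      _ = Real.exp (-(n * q / 2)) := by rw [← Real.exp_nat_mul]; ring_nf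
  have hw : Real.exp (-k) ≤ (1 / 2) ^ (i : ℕ) := by
    calc Real.exp (-k) ≤ Real.exp (-1) ^ (i : ℕ) := by
          rw [← Real.exp_nat_mul]
          exact Real.exp_le_exp.mpr (by rw [hk]; linarith)
      _ ≤ (1 / 2) ^ (i : ℕ) := by
          gcongr
          rw [Real.exp_neg, ← one_div]
          exact one_div_le_one_div_of_le (by norm_num) (by linarith [Real.exp_one_gt_d9])
  have h3 : Real.exp (-k) * p ≤ Real.exp (-(n * q / 2)) :=
    (mul_le_mul_of_nonneg_right hw hp).trans (h.trans hbase)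
  have ha2 : 26 ^ 2 ≤ a ^ 2 := by gcongr
  have h4 : p ≤ Real.exp (-(k * a ^ 3 / 4)) := by
    have h5 : p ≤ Real.exp (k + -(n * q / 2)) := by
      rw [Real.exp_add]
      calc p = Real.exp k * (Real.exp (-k) * p) := by
            rw [← mul_assoc, ← Real.exp_add]; simp
        _ ≤ _ := by gcongr
    refine h5.trans (Real.exp_le_exp.mpr ?_)
    have : k * 4 ≤ k * a ^ 3 := by
      gcongr
      nlinarith
    linarith
  have h6 := Real.pow_div_factorial_le_exp (k * a ^ 3 / 4) (by positivity) 2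
  have h7 : 10 * (n : ℝ) ≤ Real.exp (k * a ^ 3 / 4) := by
    refine le_trans ?_ h6
    have h8 : 320 ≤ k * a ^ 2 := by nlinarith
    have h9 : 320 * (k * a ^ 4) ≤ k * a ^ 2 * (k * a ^ 4) := by gcongr
    rw [hna]
    norm_num [Nat.factorial]
    nlinarith
  refine h4.trans ?_
  rw [Real.exp_neg, ← one_div]
  exact one_div_le_one_div_of_le (by positivity) h7

lemma measureReal_decRe_lt_le (i : Fin n) (hi : (i : ℝ) + 1 ≤ ((n : ℝ) + 1) / 2) :
    (Measure.pi fun _ : Fin n => gaussianReal 0 1).real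
      {x | decRe x i < 1 / 1000 * √(Real.log ((n : ℝ) / ((i : ℝ) + 1)))} ≤ 1 / (10 * n) := by
  rcases le_total 100 (Real.log ((n : ℝ) / ((i : ℝ) + 1))) with hL | hL
  · exact measureReal_decRe_lt_le_of_large i hL
  · refine measureReal_decRe_lt_le_of_small i hi (by positivity) ?_
    have : √(Real.log ((n : ℝ) / ((i : ℝ) + 1))) ≤ 10 :=
      Real.sqrt_le_iff.mpr ⟨by norm_num, by linarith⟩
    linarith

end Bounds

/-- There exist universal constants `C ≥ c > 0` such that for every `n ≥ 3`, a standard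
Gaussian vector `X` in `ℝ^n` satisfies, with probability at least `0.51`:
`c √(ln(n/i)) ≤ X_[i] ≤ C √(ln(n/i))` for all `1 ≤ i ≤ (n+1)/2`. -/
theorem simultaneous_order_statistics_bounds :
    ∃ C c : ℝ, 0 < c ∧ c ≤ C ∧
      ∀ n : ℕ, 3 ≤ n →
        (0.51 : ℝ) ≤
          ((stdGaussian n) {x | ∀ i : Fin n, ((i : ℝ) + 1) ≤ ((n : ℝ) + 1) / 2 →
            c * Real.sqrt (Real.log ((n : ℝ) / ((i : ℝ) + 1))) ≤ decRe x i ∧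
            decRe x i ≤ C * Real.sqrt (Real.log ((n : ℝ) / ((i : ℝ) + 1)))}).toReal := by
  refine ⟨11, 1 / 1000, by norm_num, by norm_num, fun n hn => ?_⟩
  change (0.51 : ℝ) ≤ (Measure.pi fun _ : Fin n => gaussianReal 0 1).real _
  set μ := Measure.pi fun _ : Fin n => gaussianReal 0 1 with hμ
  set S : Set (Fin n → ℝ) := {x | ∀ i : Fin n, ((i : ℝ) + 1) ≤ ((n : ℝ) + 1) / 2 →
    1 / 1000 * √(Real.log ((n : ℝ) / ((i : ℝ) + 1))) ≤ decRe x i ∧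
    decRe x i ≤ 11 * √(Real.log ((n : ℝ) / ((i : ℝ) + 1)))} with hS
  set U : Set (Fin n → ℝ) := {x | 10 * (n : ℝ) ≤ ∑ j, Real.exp (|x j| ^ 2 / 4)} with hU
  set A : Fin n → Set (Fin n → ℝ) := fun i => {x | (i : ℝ) + 1 ≤ ((n : ℝ) + 1) / 2 ∧
    decRe x i < 1 / 1000 * √(Real.log ((n : ℝ) / ((i : ℝ) + 1)))} with hA
  have hn' : (0 : ℝ) < n := by exact_mod_cast (by omega : 0 < n)
  have hcover : (Set.univ : Set (Fin n → ℝ)) ⊆ S ∪ (U ∪ ⋃ i, A i) := by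
    intro x _
    by_contra hx
    simp only [Set.mem_union, Set.mem_iUnion, not_or, not_exists] at hx
    obtain ⟨hxS, hxU, hxA⟩ := hx
    refine hxS fun i hi => ⟨?_, decRe_le_of_sum_exp_lt hn x (not_le.mp hxU) i hi⟩
    by_contra! hlt
    exact hxA i ⟨hi, hlt⟩
  have hUle : μ.real U ≤ 1 / 5 := measureReal_sum_exp_sq_ge_le (by omega)
  have hAle : ∀ i, μ.real (A i) ≤ 1 / (10 * n) := by
    intro i
    by_cases hi : (i : ℝ) + 1 ≤ ((n : ℝ) + 1) / 2
    · exact (measureReal_mono fun x hx => hx.2).trans (measureReal_decRe_lt_le i hi)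
    · have : A i = ∅ := by
        ext x
        simp only [hA, Set.mem_ofPred_eq, Set.mem_empty_iff_false, iff_false]
        exact fun hx => hi hx.1
      rw [this, measureReal_empty]
      positivity
  have hAsum : μ.real (⋃ i, A i) ≤ 1 / 10 :=
    calc μ.real (⋃ i, A i) ≤ ∑ i, μ.real (A i) := measureReal_iUnion_fintype_le A
      _ ≤ ∑ _i : Fin n, 1 / (10 * (n : ℝ)) := Finset.sum_le_sum fun i _ => hAle i
      _ = 1 / 10 := by
        rw [Finset.sum_const, Finset.card_univ, Fintype.card_fin, nsmul_eq_mul]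
        field_simp
  have htotal : (1 : ℝ) ≤ μ.real (S ∪ (U ∪ ⋃ i, A i)) := by
    rw [← probReal_univ (μ := μ)]
    exact measureReal_mono hcover
  have h1 := measureReal_union_le (μ := μ) S (U ∪ ⋃ i, A i)
  have h2 := measureReal_union_le (μ := μ) U (⋃ i, A i)
  norm_num1
  linarith
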